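/- Let 0 < q < ∞ and let ω be a radial continuous weight on the unit disc that is either regular or rapidly increasing. Then there exists an analytic function f on 𝔻 with f(0) ≠ 0 such that f ∈ A^p_ω for every 0 < p < q, and such that the zero sequence {z_k} of f, repeated according to multiplicity and ordered by increasing moduli, satisfies limsup_{n→∞} (∏_{k=1}^n 1/|z_k|) · (∫_{1−1/n}^1 ω(r) dr)^{1/q} > 0. In particular, there is a zero set of a function in ∩_{p<q} A^p_ω which is not the zero set of any function in A^q_ω. -/

import Mathlib

open MeasureTheory Set Filter

noncomputable section

/-- `wInt ω r = ∫_r^1 ω(s) ds`. -/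
def wInt (ω : ℝ → ℝ) (r : ℝ) : ℝ := ∫ s in r..1, ω s

/-- A radial weight on the unit disc, identified with a function on `[0,1)`:
positive and integrable. -/
def IsRadialWeight (ω : ℝ → ℝ) : Prop :=
  (∀ r ∈ Set.Ico (0:ℝ) 1, 0 < ω r) ∧ IntegrableOn ω (Set.Ico (0:ℝ) 1)

/-- A radial continuous weight. -/
def IsRadialContinuousWeight (ω : ℝ → ℝ) : Prop :=
  IsRadialWeight ω ∧ ContinuousOn ω (Set.Ico (0:ℝ) 1)

/-- A regular weight: radial continuous with `ψ_ω(r) ≍ 1 - r`, i.e.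
`(1-r)·ω(r) ≍ ∫_r^1 ω(s) ds` on `[0,1)`. -/
def IsRegularWeight (ω : ℝ → ℝ) : Prop :=
  IsRadialContinuousWeight ω ∧ ∃ c C : ℝ, 0 < c ∧ 0 < C ∧
    ∀ r ∈ Set.Ico (0:ℝ) 1,
      c * ((1 - r) * ω r) ≤ wInt ω r ∧ wInt ω r ≤ C * ((1 - r) * ω r)

/-- A rapidly increasing weight: radial continuous with
`ψ_ω(r)/(1-r) = (∫_r^1 ω)/(ω(r)(1-r)) → ∞` as `r → 1⁻`. -/
def IsRapidlyIncreasing (ω : ℝ → ℝ) : Prop :=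
  IsRadialContinuousWeight ω ∧
    Tendsto (fun r => wInt ω r / (ω r * (1 - r))) (nhdsWithin 1 (Set.Iio 1)) atTop

/-- The open unit disc in `ℂ`. -/
def unitDisc : Set ℂ := {z : ℂ | ‖z‖ < 1}

open scoped Topology

theorem prod_sub_rotated_roots {n : ℕ} (hn : 0 < n) (α ζ z : ℂ) (hζ : IsPrimitiveRoot ζ n) (m : ℕ) :
    ∏ i ∈ Finset.range n, (z - α * ζ ^ (m + i)) = z ^ n - α ^ n := by
  have h := X_pow_sub_C_eq_prod hζ (α := α * ζ ^ m) (a := α ^ n) hn (by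
    rw [mul_pow, ← pow_mul, mul_comm m n, pow_mul, hζ.pow_eq_one, one_pow, mul_one])
  have h2 := congrArg (Polynomial.eval z) h
  simp only [Polynomial.eval_sub, Polynomial.eval_pow, Polynomial.eval_X, Polynomial.eval_C,
    Polynomial.eval_prod] at h2
  rw [h2]
  refine Finset.prod_congr rfl fun i _ => ?_
  ring

/-- The index of the block `[N j, N (j + 1))` that contains `k + 1`. -/
def blockIndex (N : ℕ → ℕ) (k : ℕ) : ℕ := sInf {j | k + 1 < N (j + 1)}

theorem blockIndex_eq {N : ℕ → ℕ} (hN : StrictMono N) {j k : ℕ} (h₁ : N j ≤ k + 1)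
    (h₂ : k + 1 < N (j + 1)) : blockIndex N k = j := by
  apply le_antisymm
  · exact Nat.sInf_le h₂
  · have : k + 1 < N (blockIndex N k + 1) :=
      Nat.sInf_mem (s := {j | k + 1 < N (j + 1)}) ⟨j, h₂⟩
    have := hN.lt_iff_lt.1 (h₁.trans_lt this)
    omega

theorem blockIndex_le_succ {N : ℕ → ℕ} (hN : StrictMono N) (k : ℕ) :
    blockIndex N k ≤ blockIndex N (k + 1) := by
  have : k + 1 + 1 < N (blockIndex N (k + 1) + 1) :=
    Nat.sInf_mem (s := {j | k + 1 + 1 < N (j + 1)}) ⟨k + 1 + 1, hN.le_apply⟩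
  exact Nat.sInf_le (show k + 1 < _ by omega)

theorem prod_range_eq_prod_blocks {M : Type*} [CommMonoid M] {N e : ℕ → ℕ} (hN : StrictMono N)
    (hN0 : N 0 = 1) (he : ∀ j, N (j + 1) = N j + e j) (g : ℕ → ℕ → M) (J : ℕ) :
    ∏ k ∈ Finset.range (N J - 1), g (blockIndex N k) k =
      ∏ j ∈ Finset.range J, ∏ i ∈ Finset.range (e j), g j (N j - 1 + i) := by
  induction J with
  | zero => simp [hN0]
  | succ J ih =>
    have h1 : 1 ≤ N J := hN0 ▸ hN.monotone (Nat.zero_le J)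
    have h2 : N (J + 1) - 1 = N J - 1 + e J := by have := he J; omega
    rw [h2, Finset.prod_range_add, ih, Finset.prod_range_succ]
    congr 1
    refine Finset.prod_congr rfl fun i hi => ?_
    rw [Finset.mem_range] at hi
    rw [blockIndex_eq hN (j := J)]
    · omega
    · have := he J; omega

/-- The tail `∏_{j ≥ J} (1 + a_j z^{e_j})` of a lacunary product. -/
def lacunaryTail (a : ℕ → ℝ) (e : ℕ → ℕ) (J : ℕ) (z : ℂ) : ℂ :=
  ∏' i, (1 + (a (i + J) : ℂ) * z ^ e (i + J))

theorem isOpen_unitDisc : IsOpen unitDisc := isOpen_lt continuous_norm continuous_const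

section LacunaryProduct

variable {N e : ℕ → ℕ} {a : ℕ → ℝ}

theorem exists_lt_one_sub_one_div (hN : StrictMono N) {r : ℝ} (hr : r < 1) :
    ∃ J, ∀ j, J ≤ j → r < 1 - 1 / (N j : ℝ) := by
  obtain ⟨m, hm⟩ := exists_nat_one_div_lt (sub_pos.2 hr)
  refine ⟨m + 1, fun j hj => ?_⟩
  have h1 : ((m : ℝ) + 1) ≤ N j := by exact_mod_cast hj.trans hN.le_apply
  have := one_div_le_one_div_of_le (by positivity) h1
  linarith

theorem summable_lacunary (hN : StrictMono N)
    (hsmall : ∀ i (z : ℂ), ‖z‖ ≤ 1 - 1 / (N i : ℝ) → ‖(a i : ℂ) * z ^ e i‖ ≤ (1 / 2) ^ i)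
    (J : ℕ) {z : ℂ} (hz : z ∈ unitDisc) :
    Summable fun i => ‖(a (i + J) : ℂ) * z ^ e (i + J)‖ := by
  obtain ⟨j, hj⟩ := exists_lt_one_sub_one_div hN (show ‖z‖ < 1 from hz)
  refine (summable_nat_add_iff (f := fun i => ‖(a i : ℂ) * z ^ e i‖) J).2 ?_
  refine Summable.of_norm_bounded_eventually_nat (g := fun i => (1 / 2 : ℝ) ^ i)
    summable_geometric_two ?_
  filter_upwards [eventually_ge_atTop j] with i hi
  rw [norm_norm]
  exact hsmall i z (hj i hi).le

theorem differentiableOn_lacunaryTail (hN : StrictMono N)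
    (hsmall : ∀ i (z : ℂ), ‖z‖ ≤ 1 - 1 / (N i : ℝ) → ‖(a i : ℂ) * z ^ e i‖ ≤ (1 / 2) ^ i)
    (J : ℕ) : DifferentiableOn ℂ (lacunaryTail a e J) unitDisc := by
  intro z hz
  obtain ⟨R, hzR, hR⟩ := exists_between (show ‖z‖ < 1 from hz)
  obtain ⟨j, hj⟩ := exists_lt_one_sub_one_div hN hR
  have hopen : IsOpen (Metric.ball (0 : ℂ) R) := Metric.isOpen_ball
  have hprod := Summable.hasProdLocallyUniformlyOn_nat_one_add
    (f := fun i (w : ℂ) => (a (i + J) : ℂ) * w ^ e (i + J)) hopen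
    (u := fun i => (1 / 2 : ℝ) ^ (i + J)) ((summable_nat_add_iff J).2 summable_geometric_two)
    (by
      filter_upwards [eventually_ge_atTop j] with i hi w hw
      exact hsmall _ w ((mem_ball_zero_iff.1 hw).trans (hj _ (by omega))).le)
    (fun i => by fun_prop)
  have hd := hprod.tendstoLocallyUniformlyOn_finsetRange.differentiableOn
    (Eventually.of_forall fun n => by fun_prop) hopen
  exact (hd.differentiableAt
    (hopen.mem_nhds (mem_ball_zero_iff.2 hzR))).differentiableWithinAt

theorem prod_mul_lacunaryTail (hN : StrictMono N)
    (hsmall : ∀ i (z : ℂ), ‖z‖ ≤ 1 - 1 / (N i : ℝ) → ‖(a i : ℂ) * z ^ e i‖ ≤ (1 / 2) ^ i)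
    (J : ℕ) {z : ℂ} (hz : z ∈ unitDisc) :
    lacunaryTail a e 0 z =
      (∏ i ∈ Finset.range J, (1 + (a i : ℂ) * z ^ e i)) * lacunaryTail a e J z := by
  have h := multipliable_one_add_of_summable (summable_lacunary hN hsmall J hz)
  exact (Multipliable.prod_mul_tprod_nat_mul' (f := fun i => 1 + (a i : ℂ) * z ^ e i) h).symm

theorem exists_factor_eq_zero (hN : StrictMono N)
    (hsmall : ∀ i (z : ℂ), ‖z‖ ≤ 1 - 1 / (N i : ℝ) → ‖(a i : ℂ) * z ^ e i‖ ≤ (1 / 2) ^ i)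
    {z : ℂ} (hz : z ∈ unitDisc) (h0 : lacunaryTail a e 0 z = 0) :
    ∃ j, 1 + (a j : ℂ) * z ^ e j = 0 := by
  by_contra! h
  exact tprod_one_add_ne_zero_of_summable (fun i => h (i + 0)) (summable_lacunary hN hsmall 0 hz) h0

theorem prod_one_add_half_pow_le (s : Finset ℕ) :
    ∏ i ∈ s, (1 + (1 / 2 : ℝ) ^ i) ≤ Real.exp 2 := by
  calc ∏ i ∈ s, (1 + (1 / 2 : ℝ) ^ i) ≤ ∏ i ∈ s, Real.exp ((1 / 2 : ℝ) ^ i) := by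
        refine Finset.prod_le_prod (fun i _ => by positivity) fun i _ => ?_
        linarith [Real.add_one_le_exp ((1 / 2 : ℝ) ^ i)]
    _ = Real.exp (∑ i ∈ s, (1 / 2 : ℝ) ^ i) := (Real.exp_sum _ _).symm
    _ ≤ Real.exp 2 := Real.exp_le_exp.2 <|
        (summable_geometric_two.sum_le_tsum s fun i _ => by positivity).trans_eq tsum_geometric_two

theorem norm_lacunaryTail_le (hN : StrictMono N)
    (hsmall : ∀ i (z : ℂ), ‖z‖ ≤ 1 - 1 / (N i : ℝ) → ‖(a i : ℂ) * z ^ e i‖ ≤ (1 / 2) ^ i)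
    (ha : ∀ j, 2 ^ j ≤ a j) {z : ℂ} (hz : z ∈ unitDisc) {j : ℕ}
    (hj : ‖z‖ ≤ 1 - 1 / (N (j + 1) : ℝ)) (hpos : 0 < N 0) :
    ‖lacunaryTail a e 0 z‖ ≤
      Real.exp 2 * Real.exp 2 * ((∏ i ∈ Finset.range j, a i) * (1 + a j * ‖z‖ ^ e j)) := by
  have ha0 : ∀ i, 0 < a i := fun i => lt_of_lt_of_le (by positivity) (ha i)
  have hz1 : ‖z‖ < 1 := hz
  have hm := multipliable_one_add_of_summable (summable_lacunary hN hsmall 0 hz)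
  refine le_of_tendsto hm.hasProd.tendsto_prod_nat.norm ?_
  filter_upwards [eventually_ge_atTop (j + 1)] with m hm
  obtain ⟨l, rfl⟩ := Nat.exists_eq_add_of_le hm
  have hfac : ∀ i, ‖1 + (a i : ℂ) * z ^ e i‖ ≤ 1 + a i * ‖z‖ ^ e i := fun i => by
    refine (norm_add_le _ _).trans ?_
    rw [norm_one, norm_mul, norm_pow, Complex.norm_real, Real.norm_of_nonneg (ha0 i).le]
  simp only [add_zero]
  rw [Finset.prod_range_add, Finset.prod_range_succ, norm_mul, norm_mul, norm_prod, norm_prod]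
  have h1 : ∏ i ∈ Finset.range j, ‖1 + (a i : ℂ) * z ^ e i‖ ≤
      (∏ i ∈ Finset.range j, a i) * Real.exp 2 := by
    calc ∏ i ∈ Finset.range j, ‖1 + (a i : ℂ) * z ^ e i‖
        ≤ ∏ i ∈ Finset.range j, (a i * (1 + (1 / 2 : ℝ) ^ i)) := by
          refine Finset.prod_le_prod (fun i _ => norm_nonneg _) fun i _ => (hfac i).trans ?_
          have h2 : ‖z‖ ^ e i ≤ 1 := pow_le_one₀ (norm_nonneg _) hz1.le
          have h3 : 1 ≤ a i * (1 / 2 : ℝ) ^ i := by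
            rw [one_div, inv_pow, ← div_eq_mul_inv, le_div_iff₀ (by positivity), one_mul]
            exact ha i
          nlinarith [ha0 i]
      _ ≤ _ := by
          rw [Finset.prod_mul_distrib]
          exact mul_le_mul_of_nonneg_left (prod_one_add_half_pow_le _)
            (Finset.prod_nonneg fun i _ => (ha0 i).le)
  have h2 : ∏ i ∈ Finset.range l, ‖1 + (a (j + 1 + i) : ℂ) * z ^ e (j + 1 + i)‖ ≤ Real.exp 2 := by
    refine le_trans (Finset.prod_le_prod (fun i _ => norm_nonneg _) (g := fun i =>
      1 + (1 / 2 : ℝ) ^ i) fun i _ => ?_) (prod_one_add_half_pow_le _)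
    have hle : ‖z‖ ≤ 1 - 1 / (N (j + 1 + i) : ℝ) := by
      have h3 : 0 < N (j + 1) := hpos.trans_le (hN.monotone (Nat.zero_le _))
      have h4 : (N (j + 1) : ℝ) ≤ N (j + 1 + i) := by exact_mod_cast hN.monotone (by omega)
      have := one_div_le_one_div_of_le (by exact_mod_cast h3) h4
      linarith
    refine (norm_add_le _ _).trans ?_
    rw [norm_one]
    have h5 : (1 / 2 : ℝ) ^ (j + 1 + i) ≤ (1 / 2) ^ i :=
      pow_le_pow_of_le_one (by norm_num) (by norm_num) (by omega)
    linarith [hsmall _ z hle]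
  calc _ ≤ ((∏ i ∈ Finset.range j, a i) * Real.exp 2) * (1 + a j * ‖z‖ ^ e j) * Real.exp 2 := by
        have := ha0 j
        have := Finset.prod_nonneg (s := Finset.range j) fun i _ => (ha0 i).le
        gcongr
        exact hfac j
    _ = _ := by ring

/-- The zeros `z` of the factors `1 + a_j z^{e_j}`, listed block by block. -/
def lacunaryZero (a : ℕ → ℝ) (e : ℕ → ℕ) (j k : ℕ) : ℂ :=
  (((a j)⁻¹ ^ ((e j : ℝ)⁻¹) : ℝ) : ℂ) * Complex.exp (Real.pi * Complex.I / e j) *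
    Complex.exp (2 * Real.pi * Complex.I / e j) ^ k

theorem norm_lacunaryZero {j : ℕ} (ha : 0 < a j) (k : ℕ) :
    ‖lacunaryZero a e j k‖ = (a j)⁻¹ ^ ((e j : ℝ)⁻¹) := by
  have h1 : ‖Complex.exp (Real.pi * Complex.I / e j)‖ = 1 := by
    rw [show (Real.pi * Complex.I / e j : ℂ) = ((Real.pi / e j : ℝ) : ℂ) * Complex.I by
      push_cast; ring]
    exact Complex.norm_exp_ofReal_mul_I _
  have h2 : ‖Complex.exp (2 * Real.pi * Complex.I / e j)‖ = 1 := by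
    rw [show (2 * Real.pi * Complex.I / e j : ℂ) = ((2 * Real.pi / e j : ℝ) : ℂ) * Complex.I by
      push_cast; ring]
    exact Complex.norm_exp_ofReal_mul_I _
  rw [lacunaryZero, norm_mul, norm_mul, norm_pow, h1, h2, one_pow, mul_one, mul_one,
    Complex.norm_real, Real.norm_of_nonneg (by positivity)]

theorem one_add_mul_pow_eq {j : ℕ} (ha : 0 < a j) (he : 0 < e j) (m : ℕ) (z : ℂ) :
    1 + (a j : ℂ) * z ^ e j =
      a j * ∏ i ∈ Finset.range (e j), (z - lacunaryZero a e j (m + i)) := by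
  have hne : (e j : ℂ) ≠ 0 := by exact_mod_cast he.ne'
  have ha' : (a j : ℂ) ≠ 0 := by exact_mod_cast ha.ne'
  unfold lacunaryZero
  rw [prod_sub_rotated_roots he _ _ z (Complex.isPrimitiveRoot_exp _ he.ne') m, mul_pow,
    ← Complex.exp_nat_mul, mul_div_cancel₀ _ hne, Complex.exp_pi_mul_I, ← Complex.ofReal_pow,
    Real.rpow_inv_natCast_pow (by positivity) he.ne']
  push_cast
  field_simp
  ring

end LacunaryProduct

section Majorant

variable {φ : ℝ → ℝ} {γ : ℝ}

theorem one_sub_one_div_mem_Ico {n : ℕ} (hn : 1 ≤ n) : 1 - 1 / (n : ℝ) ∈ Ico (0 : ℝ) 1 := by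
  have h : (1 : ℝ) ≤ n := by exact_mod_cast hn
  have h1 : 1 / (n : ℝ) ≤ 1 := by rw [div_le_one (by linarith)]; exact h
  have h2 : 0 < 1 / (n : ℝ) := by positivity
  constructor <;> linarith

theorem exists_next_exponent (hpos : ∀ r ∈ Ico (0 : ℝ) 1, 0 < φ r)
    (hdoub : ∀ r t, 0 ≤ r → r ≤ t → t < 1 → φ t ≤ ((1 - r) / (1 - t)) ^ γ * φ r)
    (hlim : Tendsto φ (𝓝[<] 1) atTop) {n : ℕ} (hn : 1 ≤ n) :
    ∃ n' : ℕ, 2 * n ≤ n' ∧ 2 ^ n * φ (1 - 1 / n) ≤ φ (1 - 1 / n') ∧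
      φ (1 - 1 / n') * 2 ^ n ≤ φ (1 - 1 / n) * 2 ^ (((n' : ℝ) - n) / n) := by
  have hn0 : (0 : ℝ) < n := by exact_mod_cast hn
  have hφn := hpos _ (one_sub_one_div_mem_Ico hn)
  have hφ0 := hpos 0 (by simp)
  have hto : Tendsto (fun m : ℕ => 1 - 1 / (m : ℝ)) atTop (𝓝[<] 1) := by
    refine tendsto_nhdsWithin_iff.2 ⟨?_, ?_⟩
    · simpa using tendsto_one_div_atTop_nhds_zero_nat.const_sub (1 : ℝ)
    · filter_upwards [eventually_ge_atTop 1] with m hm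
      exact (one_sub_one_div_mem_Ico hm).2
  have h1 := (hlim.comp hto).eventually_ge_atTop (2 ^ n * φ (1 - 1 / n))
  have h2 := (tendsto_rpow_mul_exp_neg_mul_atTop_nhds_zero γ (Real.log 2 / n)
    (div_pos (Real.log_pos one_lt_two) hn0)).comp tendsto_natCast_atTop_atTop
  have h3 := h2.eventually (gt_mem_nhds
    (show 0 < φ (1 - 1 / n) * (1 / 2) / (φ 0 * 2 ^ n) by positivity))
  obtain ⟨m, ha, hb, hc, hd⟩ := (h1.and (h3.and ((eventually_ge_atTop (2 * n)).and
    (eventually_ge_atTop 1)))).exists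
  refine ⟨m, hc, ha, ?_⟩
  simp only [Function.comp] at hb
  have hm := one_sub_one_div_mem_Ico hd
  have h4 : φ (1 - 1 / m) ≤ (m : ℝ) ^ γ * φ 0 := by
    simpa using hdoub 0 _ le_rfl hm.1 hm.2
  have h5 : (2 : ℝ) ^ (((m : ℝ) - n) / n) = 1 / 2 / Real.exp (-(Real.log 2 / n) * m) := by
    rw [Real.rpow_def_of_pos two_pos, sub_div, div_self hn0.ne', mul_sub, Real.exp_sub, mul_one,
      Real.exp_log two_pos, neg_mul, Real.exp_neg]
    rw [show Real.log 2 * (m / n) = Real.log 2 / n * m by ring]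
    field_simp
  rw [h5]
  rw [lt_div_iff₀ (by positivity)] at hb
  rw [← mul_div_assoc, le_div_iff₀ (Real.exp_pos _)]
  refine le_trans ?_ hb.le
  calc _ ≤ (m : ℝ) ^ γ * φ 0 * 2 ^ n * Real.exp (-(Real.log 2 / n) * m) := by gcongr
    _ = _ := by ring

theorem exists_rpow_mul_exp_le (γ : ℝ) :
    ∃ C, ∀ x : ℝ, 1 ≤ x → x ^ γ * Real.exp (-(1 / 2) * x) ≤ C := by
  have hc : ContinuousOn (fun x : ℝ => x ^ γ * Real.exp (-(1 / 2) * x)) (Ici 1) := by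
    refine ContinuousOn.mul (fun x hx => ?_) (by fun_prop)
    exact (Real.continuousAt_rpow_const x γ
      (Or.inl (by have : (1:ℝ) ≤ x := hx; positivity))).continuousWithinAt
  obtain ⟨M, hM⟩ := (((tendsto_rpow_mul_exp_neg_mul_atTop_nhds_zero γ (1 / 2)
    (by norm_num)).eventually (gt_mem_nhds one_pos))).exists_forall_of_atTop
  obtain ⟨C, hC⟩ := (isCompact_Icc (a := (1 : ℝ)) (b := M)).bddAbove_image
    (hc.mono Icc_subset_Ici_self)
  refine ⟨max C 1, fun x hx => ?_⟩
  rcases le_total x M with h | h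
  · exact (hC (mem_image_of_mem _ ⟨hx, h⟩)).trans (le_max_left _ _)
  · exact (hM x h).le.trans (le_max_right _ _)

theorem exists_exponents (hpos : ∀ r ∈ Ico (0 : ℝ) 1, 0 < φ r)
    (hdoub : ∀ r t, 0 ≤ r → r ≤ t → t < 1 → φ t ≤ ((1 - r) / (1 - t)) ^ γ * φ r)
    (hlim : Tendsto φ (𝓝[<] 1) atTop) :
    ∃ N : ℕ → ℕ, N 0 = 1 ∧ ∀ j, 2 * N j ≤ N (j + 1) ∧
      2 ^ N j * φ (1 - 1 / N j) ≤ φ (1 - 1 / N (j + 1)) ∧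
      φ (1 - 1 / N (j + 1)) * 2 ^ N j ≤
        φ (1 - 1 / N j) * 2 ^ (((N (j + 1) : ℝ) - N j) / N j) := by
  choose g hg using fun (n : ℕ) (hn : 1 ≤ n) => exists_next_exponent hpos hdoub hlim hn
  let s : ℕ → {n : ℕ // 1 ≤ n} := fun j =>
    Nat.rec ⟨1, le_rfl⟩ (fun _ n => ⟨g n n.2, by have := (hg n n.2).1; have := n.2; omega⟩) j
  exact ⟨fun j => (s j).1, rfl, fun j => hg (s j).1 (s j).2⟩

theorem exists_zeros_of_majorant (hpos : ∀ r ∈ Ico (0 : ℝ) 1, 0 < φ r)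
    (hmono : MonotoneOn φ (Ico 0 1))
    (hdoub : ∀ r t, 0 ≤ r → r ≤ t → t < 1 → φ t ≤ ((1 - r) / (1 - t)) ^ γ * φ r)
    (hlim : Tendsto φ (𝓝[<] 1) atTop) :
    ∃ (f : ℂ → ℂ) (Z : ℕ → ℂ),
      DifferentiableOn ℂ f unitDisc ∧ f 0 ≠ 0 ∧
      (∃ C, ∀ z ∈ unitDisc, ‖f z‖ ≤ C * φ ‖z‖) ∧
      (∀ k, Z k ∈ unitDisc) ∧ (∀ k, ‖Z k‖ ≤ ‖Z (k + 1)‖) ∧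
      (∀ s : Finset ℕ, ∃ g : ℂ → ℂ, DifferentiableOn ℂ g unitDisc ∧
        ∀ z ∈ unitDisc, f z = (∏ k ∈ s, (z - Z k)) * g z) ∧
      (∀ z ∈ unitDisc, f z = 0 → ∃ k, Z k = z) ∧
      ∃ c : ℝ, 0 < c ∧ ∃ᶠ n : ℕ in atTop,
        1 ≤ n ∧ c * φ (1 - 1 / n) ≤ ∏ k ∈ Finset.range n, (1 / ‖Z k‖) := by
  obtain ⟨N, hN0, hN⟩ := exists_exponents hpos hdoub hlim
  have hN1 : ∀ j, 1 ≤ N j := fun j => by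
    induction j with
    | zero => exact hN0.ge
    | succ j ih => have := (hN j).1; omega
  have hNmono : StrictMono N := strictMono_nat_of_lt_succ fun j => by
    have := (hN j).1; have := hN1 j; omega
  have hφN : ∀ j, 0 < φ (1 - 1 / N j) := fun j => hpos _ (one_sub_one_div_mem_Ico (hN1 j))
  have hNpos : ∀ j, (0 : ℝ) < N j := fun j => by exact_mod_cast hN1 j
  set e : ℕ → ℕ := fun j => N (j + 1) - N j with he_def
  set a : ℕ → ℝ := fun j => φ (1 - 1 / N (j + 1)) / φ (1 - 1 / N j) with ha_def
  have he : ∀ j, N (j + 1) = N j + e j := fun j => by have := (hN j).1; simp only [he_def]; omega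
  have hepos : ∀ j, 0 < e j := fun j => by have := (hN j).1; have := hN1 j; simp only [he_def]; omega
  have heR : ∀ j, (e j : ℝ) = N (j + 1) - N j := fun j => by rw [he j]; push_cast; ring
  have haN : ∀ j, 2 ^ N j ≤ a j := fun j => (le_div_iff₀ (hφN j)).2 (hN j).2.1
  have ha2 : ∀ j, 2 ^ j ≤ a j := fun j =>
    (pow_le_pow_right₀ one_le_two hNmono.le_apply).trans (haN j)
  have hatwo : ∀ j, 2 ≤ a j := fun j => by
    simpa using (pow_le_pow_right₀ one_le_two (hN1 j)).trans (haN j)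
  have ha0 : ∀ j, 0 < a j := fun j => by linarith [hatwo j]
  have hale : ∀ j, a j * 2 ^ N j ≤ 2 ^ ((e j : ℝ) / N j) := fun j => by
    rw [heR, ha_def, div_mul_eq_mul_div, div_le_iff₀ (hφN j), mul_comm (_ ^ (_ / _) : ℝ)]
    exact (hN j).2.2
  have hprod : ∀ J, ∏ j ∈ Finset.range J, a j = φ (1 - 1 / N J) / φ 0 := fun J => by
    induction J with
    | zero => simp [hN0, (hpos 0 (by simp)).ne']
    | succ J ih =>
      rw [Finset.prod_range_succ, ih, ha_def]
      have := (hφN J).ne'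
      field_simp
  have hsmall : ∀ i (z : ℂ), ‖z‖ ≤ 1 - 1 / (N i : ℝ) → ‖(a i : ℂ) * z ^ e i‖ ≤ (1 / 2) ^ i := by
    intro i z hz
    rw [norm_mul, norm_pow, Complex.norm_real, Real.norm_of_nonneg (ha0 i).le]
    have h1 : ‖z‖ ≤ 2 ^ (-(1 / (N i : ℝ))) := by
      rw [Real.rpow_def_of_pos two_pos]
      have h2 := Real.add_one_le_exp (Real.log 2 * -(1 / (N i : ℝ)))
      have h3 : Real.log 2 ≤ 1 := by linarith [Real.log_two_lt_d9]
      have h4 : 0 < 1 / (N i : ℝ) := by have := hNpos i; positivity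
      nlinarith
    have h2 : ‖z‖ ^ e i ≤ (2 ^ ((e i : ℝ) / N i))⁻¹ := by
      refine (pow_le_pow_left₀ (norm_nonneg _) h1 _).trans_eq ?_
      rw [← Real.rpow_natCast, ← Real.rpow_mul zero_le_two, ← Real.rpow_neg zero_le_two]
      congr 1
      ring
    have h3 : (0 : ℝ) < 2 ^ ((e i : ℝ) / N i) := by positivity
    calc a i * ‖z‖ ^ e i ≤ a i * (2 ^ ((e i : ℝ) / N i))⁻¹ :=
          mul_le_mul_of_nonneg_left h2 (ha0 i).le
      _ ≤ (1 / 2) ^ N i := by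
          rw [← div_eq_mul_inv, div_le_iff₀ h3, one_div, inv_pow, inv_mul_eq_div,
            le_div_iff₀ (by positivity)]
          exact hale i
      _ ≤ _ := pow_le_pow_of_le_one (by norm_num) (by norm_num) hNmono.le_apply
  have hroot : ∀ j, (a j)⁻¹ ^ ((e j : ℝ)⁻¹) ≤ (a (j + 1))⁻¹ ^ ((e (j + 1) : ℝ)⁻¹) := by
    intro j
    have hej : (0 : ℝ) < e j := by exact_mod_cast hepos j
    have hej' : (0 : ℝ) < e (j + 1) := by exact_mod_cast hepos (j + 1)
    rw [Real.inv_rpow (ha0 _).le, Real.inv_rpow (ha0 _).le]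
    refine inv_anti₀ (by have := ha0 (j + 1); positivity) ?_
    calc a (j + 1) ^ ((e (j + 1) : ℝ)⁻¹)
        ≤ (2 ^ ((e (j + 1) : ℝ) / N (j + 1))) ^ ((e (j + 1) : ℝ)⁻¹) := by
          refine Real.rpow_le_rpow (ha0 _).le ?_ (by positivity)
          refine le_trans ?_ (hale (j + 1))
          exact le_mul_of_one_le_right (ha0 _).le (one_le_pow₀ one_le_two)
      _ = 2 ^ ((N (j + 1) : ℝ)⁻¹) := by
          rw [← Real.rpow_mul zero_le_two]
          congr 1
          field_simp
      _ ≤ 2 ^ ((e j : ℝ)⁻¹) := by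
          refine Real.rpow_le_rpow_of_exponent_le one_le_two (inv_anti₀ hej ?_)
          rw [heR]
          linarith [hNpos j]
      _ ≤ a j ^ ((e j : ℝ)⁻¹) := Real.rpow_le_rpow zero_le_two (hatwo j) (by positivity)
  set Z : ℕ → ℂ := fun k => lacunaryZero a e (blockIndex N k) k with hZ
  have hnormZ : ∀ k, ‖Z k‖ = (a (blockIndex N k))⁻¹ ^ ((e (blockIndex N k) : ℝ)⁻¹) :=
    fun k => norm_lacunaryZero (ha0 _) k
  have hblocks : ∀ J (z : ℂ), ∏ k ∈ Finset.range (N J - 1), (z - Z k) =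
      ∏ j ∈ Finset.range J, ((a j : ℂ)⁻¹ * (1 + (a j : ℂ) * z ^ e j)) := fun J z => by
    rw [hZ, prod_range_eq_prod_blocks hNmono hN0 he (fun j k => z - lacunaryZero a e j k)]
    refine Finset.prod_congr rfl fun j _ => ?_
    have : (a j : ℂ) ≠ 0 := by exact_mod_cast (ha0 j).ne'
    rw [one_add_mul_pow_eq (ha0 j) (hepos j) (N j - 1) z, inv_mul_cancel_left₀ this]
  refine ⟨lacunaryTail a e 0, Z, differentiableOn_lacunaryTail hNmono hsmall 0, ?_, ?_, ?_, ?_,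
    ?_, ?_, ?_⟩
  · intro h0
    obtain ⟨j, hj⟩ := exists_factor_eq_zero hNmono hsmall (show (0 : ℂ) ∈ unitDisc by
      simp [unitDisc]) h0
    simp [(hepos j).ne'] at hj
  · obtain ⟨C, hC⟩ := exists_rpow_mul_exp_le γ
    refine ⟨Real.exp 2 * Real.exp 2 * ((1 + C) / φ 0), fun z hz => ?_⟩
    have hz1 : ‖z‖ < 1 := hz
    have hφ0 := hpos 0 (by simp)
    have hφz := hpos _ ⟨norm_nonneg z, hz1⟩
    have hex : ∃ j, ‖z‖ < 1 - 1 / (N (j + 1) : ℝ) := by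
      obtain ⟨J, hJ⟩ := exists_lt_one_sub_one_div hNmono hz1
      exact ⟨J, hJ _ (by omega)⟩
    obtain ⟨j, hj, hj'⟩ : ∃ j, ‖z‖ < 1 - 1 / (N (j + 1) : ℝ) ∧ 1 - 1 / (N j : ℝ) ≤ ‖z‖ := by
      classical
      refine ⟨Nat.find hex, Nat.find_spec hex, ?_⟩
      rcases h : Nat.find hex with _ | j
      · simp [hN0]
      · exact not_lt.1 (Nat.find_min hex (m := j) (by omega))
    refine (norm_lacunaryTail_le hNmono hsmall ha2 hz hj.le (by omega)).trans ?_
    rw [mul_assoc _ ((1 + C) / φ 0)]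
    refine mul_le_mul_of_nonneg_left ?_ (by positivity)
    have h1 : φ (1 - 1 / N j) ≤ φ ‖z‖ :=
      hmono (one_sub_one_div_mem_Ico (hN1 j)) ⟨norm_nonneg z, hz1⟩ hj'
    set x : ℝ := (1 - ‖z‖) * N (j + 1) with hx
    have hx1 : 1 ≤ x := by
      have h2 : 1 / (N (j + 1) : ℝ) ≤ 1 - ‖z‖ := by linarith
      rwa [div_le_iff₀ (hNpos _)] at h2
    have h2 : φ (1 - 1 / N (j + 1)) ≤ x ^ γ * φ ‖z‖ := by
      have h3 := one_sub_one_div_mem_Ico (hN1 (j + 1))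
      have h4 := hdoub _ _ (norm_nonneg z) hj.le h3.2
      rwa [sub_sub_cancel, div_div_eq_mul_div, div_one] at h4
    have h3 : ‖z‖ ^ e j ≤ Real.exp (-(1 / 2) * x) := by
      have h4 : ‖z‖ ≤ Real.exp (-(1 - ‖z‖)) := by
        linarith [Real.add_one_le_exp (-(1 - ‖z‖))]
      refine (pow_le_pow_left₀ (norm_nonneg _) h4 _).trans ?_
      rw [← Real.exp_nat_mul, Real.exp_le_exp, heR, hx]
      have h5 : 2 * (N j : ℝ) ≤ N (j + 1) := by exact_mod_cast (hN j).1
      nlinarith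
    have h4 : φ (1 - 1 / N (j + 1)) * ‖z‖ ^ e j ≤ C * φ ‖z‖ :=
      calc φ (1 - 1 / N (j + 1)) * ‖z‖ ^ e j
          ≤ x ^ γ * φ ‖z‖ * Real.exp (-(1 / 2) * x) := by
            have := hφN (j + 1)
            gcongr
        _ = x ^ γ * Real.exp (-(1 / 2) * x) * φ ‖z‖ := by ring
        _ ≤ C * φ ‖z‖ := mul_le_mul_of_nonneg_right (hC x hx1) hφz.le
    rw [mul_add, mul_one, ← mul_assoc, ← Finset.prod_range_succ, hprod, hprod, div_mul_eq_mul_div,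
      ← add_div, div_mul_eq_mul_div]
    refine div_le_div_of_nonneg_right ?_ hφ0.le
    linarith
  · intro k
    show ‖Z k‖ < 1
    rw [hnormZ]
    refine Real.rpow_lt_one (by have := ha0 (blockIndex N k); positivity) ?_ ?_
    · exact inv_lt_one_of_one_lt₀ (by linarith [hatwo (blockIndex N k)])
    · have : (0 : ℝ) < e (blockIndex N k) := by exact_mod_cast hepos _
      positivity
  · intro k
    rw [hnormZ, hnormZ]
    exact monotone_nat_of_le_succ (f := fun j => (a j)⁻¹ ^ ((e j : ℝ)⁻¹)) hroot
      (blockIndex_le_succ hNmono k)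
  · intro s
    obtain ⟨m, hm⟩ := s.exists_nat_subset_range
    have hs : s ⊆ Finset.range (N (m + 1) - 1) := fun k hk => by
      have h1 := Finset.mem_range.1 (hm hk)
      have h2 : m + 1 ≤ N (m + 1) := hNmono.le_apply
      exact Finset.mem_range.2 (by omega)
    refine ⟨fun z => (∏ k ∈ Finset.range (N (m + 1) - 1) \ s, (z - Z k)) *
      ((∏ j ∈ Finset.range (m + 1), (a j : ℂ)) * lacunaryTail a e (m + 1) z), ?_, fun z hz => ?_⟩
    · exact DifferentiableOn.mul (by fun_prop)
        ((differentiableOn_lacunaryTail hNmono hsmall (m + 1)).const_mul _)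
    · have h0 : ∏ j ∈ Finset.range (m + 1), (a j : ℂ) ≠ 0 :=
        Finset.prod_ne_zero_iff.2 fun j _ => by exact_mod_cast (ha0 j).ne'
      rw [prod_mul_lacunaryTail hNmono hsmall (m + 1) hz, ← mul_assoc (∏ k ∈ s, _),
        mul_comm (∏ k ∈ s, _), Finset.prod_sdiff hs, hblocks, Finset.prod_mul_distrib,
        Finset.prod_inv_distrib]
      field_simp
  · intro z hz h0
    obtain ⟨j, hj⟩ := exists_factor_eq_zero hNmono hsmall hz h0
    have h1 : ∏ k ∈ Finset.range (N (j + 1) - 1), (z - Z k) = 0 := by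
      rw [hblocks]
      exact Finset.prod_eq_zero (Finset.self_mem_range_succ j) (by rw [hj, mul_zero])
    obtain ⟨k, -, hk⟩ := Finset.prod_eq_zero_iff.1 h1
    exact ⟨k, (sub_eq_zero.1 hk).symm⟩
  · refine ⟨1 / φ 0, by have := hpos 0 (by simp); positivity, ?_⟩
    rw [frequently_atTop]
    intro m
    have h2 : m + 2 ≤ N (m + 2) := hNmono.le_apply
    refine ⟨N (m + 2) - 1, by omega, by omega, ?_⟩
    have h1 : ∏ k ∈ Finset.range (N (m + 2) - 1), (1 / ‖Z k‖) =
        φ (1 - 1 / N (m + 2)) / φ 0 := by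
      have h3 := congrArg norm (hblocks (m + 2) 0)
      simp only [norm_prod, zero_sub, norm_neg, norm_inv, Complex.norm_real,
        zero_pow (hepos _).ne', mul_zero, add_zero, mul_one,
        Real.norm_of_nonneg (ha0 _).le] at h3
      simp only [one_div ‖_‖]
      rw [Finset.prod_inv_distrib, h3, Finset.prod_inv_distrib, inv_inv, hprod]
    rw [h1, one_div_mul_eq_div]
    have h3 : 1 ≤ N (m + 2) - 1 := by omega
    refine div_le_div_of_nonneg_right (hmono (one_sub_one_div_mem_Ico h3)
      (one_sub_one_div_mem_Ico (hN1 _)) ?_) (hpos 0 (by simp)).le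
    have h4 : ((N (m + 2) - 1 : ℕ) : ℝ) ≤ N (m + 2) := by exact_mod_cast Nat.sub_le _ _
    have := one_div_le_one_div_of_le (by exact_mod_cast h3) h4
    linarith

end Majorant

section Weight

variable {ω : ℝ → ℝ}

theorem IsRadialWeight.integrableOn_Icc (h : IsRadialWeight ω) {r : ℝ} (hr : 0 ≤ r) :
    IntegrableOn ω (Icc r 1) := by
  rw [integrableOn_Icc_iff_integrableOn_Ico]
  exact h.2.mono_set (Ico_subset_Ico_left hr)

theorem IsRadialWeight.intervalIntegrable (h : IsRadialWeight ω) {r t : ℝ} (hr : 0 ≤ r)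
    (hrt : r ≤ t) (ht : t ≤ 1) : IntervalIntegrable ω volume r t := by
  rw [intervalIntegrable_iff_integrableOn_Icc_of_le hrt]
  exact (h.integrableOn_Icc hr).mono_set (Icc_subset_Icc_right ht)

theorem IsRadialWeight.wInt_pos (h : IsRadialWeight ω) {r : ℝ} (hr : r ∈ Ico (0 : ℝ) 1) :
    0 < wInt ω r :=
  intervalIntegral.intervalIntegral_pos_of_pos_on (h.intervalIntegrable hr.1 hr.2.le le_rfl)
    (fun x hx => h.1 x ⟨hr.1.trans hx.1.le, hx.2⟩) hr.2

theorem IsRadialWeight.wInt_antitone (h : IsRadialWeight ω) : AntitoneOn (wInt ω) (Ico 0 1) := by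
  intro r hr t ht hrt
  have h1 := intervalIntegral.integral_add_adjacent_intervals
    (h.intervalIntegrable hr.1 hrt ht.2.le) (h.intervalIntegrable ht.1 ht.2.le le_rfl)
  have h2 : 0 ≤ ∫ s in r..t, ω s := intervalIntegral.integral_nonneg hrt fun s hs =>
    (h.1 s ⟨hr.1.trans hs.1, hs.2.trans_lt ht.2⟩).le
  unfold wInt
  linarith

theorem IsRadialWeight.continuousOn_wInt (h : IsRadialWeight ω) :
    ContinuousOn (wInt ω) (Icc 0 1) := by
  have := intervalIntegral.continuousOn_primitive_interval_left (a := 0) (b := 1) (f := ω)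
    (μ := volume) (by rw [uIcc_of_le zero_le_one]; exact h.integrableOn_Icc le_rfl)
  rwa [uIcc_of_le zero_le_one] at this

theorem IsRadialContinuousWeight.hasDerivAt_wInt (h : IsRadialContinuousWeight ω) {r : ℝ}
    (hr : r ∈ Ioo (0 : ℝ) 1) : HasDerivAt (wInt ω) (-ω r) r := by
  have hc : ContinuousOn ω (Ioo 0 1) := h.2.mono Ioo_subset_Ico_self
  exact intervalIntegral.integral_hasDerivAt_left (h.1.intervalIntegrable hr.1.le hr.2.le le_rfl)
    (hc.stronglyMeasurableAtFilter isOpen_Ioo r hr) (hc.continuousAt (isOpen_Ioo.mem_nhds hr))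

theorem exists_mul_le_mul_wInt (hω : IsRegularWeight ω ∨ IsRapidlyIncreasing ω) :
    ∃ β : ℝ, ∀ r ∈ Ico (0 : ℝ) 1, (1 - r) * ω r ≤ β * wInt ω r := by
  rcases hω with ⟨h, c, C, hc, hC, hcC⟩ | ⟨h, hlim⟩
  · refine ⟨c⁻¹, fun r hr => ?_⟩
    rw [inv_mul_eq_div, le_div_iff₀ hc, mul_comm]
    exact (hcC r hr).1
  · obtain ⟨l, hl, hl'⟩ := (mem_nhdsLT_iff_exists_Ioo_subset' zero_lt_one).1
      (hlim.eventually_ge_atTop 1)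
    have hl1 : l < 1 := hl
    set m := max l 0 with hm
    have hm1 : m < 1 := max_lt hl1 one_pos
    have hm0 : 0 ≤ m := le_max_right _ _
    obtain ⟨M, hM⟩ := (isCompact_Icc (a := (0 : ℝ)) (b := m)).bddAbove_image
      (h.2.mono (Icc_subset_Ico_right hm1))
    have hwm := h.1.wInt_pos ⟨hm0, hm1⟩
    refine ⟨max 1 (M / wInt ω m), fun r hr => ?_⟩
    have hωr := h.1.1 r hr
    have hwr := h.1.wInt_pos hr
    have h1r : 0 < 1 - r := by linarith [hr.2]
    rcases le_or_gt r m with hrm | hrm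
    · have h1 : ω r ≤ M := hM (mem_image_of_mem _ ⟨hr.1, hrm⟩)
      have h2 : wInt ω m ≤ wInt ω r := h.1.wInt_antitone hr ⟨hm0, hm1⟩ hrm
      calc (1 - r) * ω r ≤ M := by nlinarith [hr.1]
        _ = M / wInt ω m * wInt ω m := by field_simp
        _ ≤ max 1 (M / wInt ω m) * wInt ω r := by gcongr; exact le_max_right _ _
    · have h1 : 1 ≤ wInt ω r / (ω r * (1 - r)) := hl' ⟨(le_max_left _ _).trans_lt hrm, hr.2⟩
      rw [le_div_iff₀ (by positivity)] at h1
      calc (1 - r) * ω r ≤ 1 * wInt ω r := by linarith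
        _ ≤ _ := by gcongr; exact le_max_left _ _

theorem wInt_le_rpow_mul_wInt (h : IsRadialContinuousWeight ω) {β : ℝ}
    (hβ : ∀ r ∈ Ico (0 : ℝ) 1, (1 - r) * ω r ≤ β * wInt ω r) {r t : ℝ} (hr : 0 ≤ r) (hrt : r ≤ t)
    (ht : t < 1) : wInt ω r ≤ ((1 - r) / (1 - t)) ^ β * wInt ω t := by
  have hmono : MonotoneOn (fun s => wInt ω s * (1 - s) ^ (-β)) (Ico 0 1) := by
    refine monotoneOn_of_hasDerivWithinAt_nonneg (convex_Ico 0 1)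
      (f' := fun s => -ω s * (1 - s) ^ (-β) + wInt ω s * (-1 * -β * (1 - s) ^ (-β - 1))) ?_ ?_ ?_
    · refine (h.1.continuousOn_wInt.mono Ico_subset_Icc_self).mul ?_
      exact ContinuousOn.rpow_const (by fun_prop) fun x hx => Or.inl (by linarith [hx.2])
    · intro x hx
      rw [interior_Ico] at hx
      refine ((h.hasDerivAt_wInt hx).mul ?_).hasDerivWithinAt
      exact ((hasDerivAt_id x).const_sub 1).rpow_const (Or.inl (by simp; linarith [hx.2]))
    · intro x hx
      rw [interior_Ico] at hx
      have hx1 : 0 < 1 - x := by linarith [hx.2]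
      have h1 := hβ x (Ioo_subset_Ico_self hx)
      have h2 : (1 - x) ^ (-β) = (1 - x) ^ (-β - 1) * (1 - x) := by
        rw [← Real.rpow_add_one hx1.ne', sub_add_cancel]
      rw [h2]
      have h3 : 0 ≤ (1 - x) ^ (-β - 1) * (β * wInt ω x - (1 - x) * ω x) :=
        mul_nonneg (by positivity) (by linarith)
      linarith
  have h1 : 0 < 1 - t := by linarith
  have h2 : 0 < 1 - r := by linarith
  have h3 := hmono ⟨hr, hrt.trans_lt ht⟩ ⟨hr.trans hrt, ht⟩ hrt
  simp only [Real.rpow_neg h1.le, Real.rpow_neg h2.le, ← div_eq_mul_inv] at h3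
  rw [div_le_iff₀ (by positivity)] at h3
  rw [Real.div_rpow h2.le h1.le]
  calc _ ≤ _ := h3
    _ = _ := by ring

theorem integrableOn_wInt_rpow_mul (h : IsRadialContinuousWeight ω) {s : ℝ} (hs : s < 1) :
    IntegrableOn (fun r => wInt ω r ^ (-s) * ω r) (Ioc 0 1) := by
  have hs' : 0 < 1 - s := by linarith
  refine intervalIntegral.integrableOn_deriv_of_nonneg
    (g := fun r => -(wInt ω r ^ (1 - s) / (1 - s))) ?_ ?_ ?_
  · exact ((h.1.continuousOn_wInt.rpow_const fun x hx => Or.inr hs'.le).div_const _).neg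
  · intro r hr
    have hw := h.1.wInt_pos (Ioo_subset_Ico_self hr)
    refine (((h.hasDerivAt_wInt hr).rpow_const (p := 1 - s) (Or.inl hw.ne')).div_const
      (1 - s)).neg.congr_deriv ?_
    rw [show 1 - s - 1 = -s by ring]
    field_simp
  · intro r hr
    have hw := h.1.wInt_pos (Ioo_subset_Ico_self hr)
    have := h.1.1 r (Ioo_subset_Ico_self hr)
    positivity

theorem integrableOn_unitDisc_of_radial {g : ℝ → ℝ} (hg : IntegrableOn g (Ioc 0 1)) :
    IntegrableOn (fun z : ℂ => g ‖z‖) unitDisc := by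
  have hmeas : MeasurableSet unitDisc := isOpen_unitDisc.measurableSet
  rw [← integrable_indicator_iff hmeas]
  have heq : unitDisc.indicator (fun z : ℂ => g ‖z‖) = fun z => (Iio (1 : ℝ)).indicator g ‖z‖ := by
    ext z
    by_cases hz : ‖z‖ < 1 <;> simp [indicator, unitDisc, hz]
  rw [heq, integrable_fun_norm_addHaar, Complex.finrank_real_complex]
  have h1 : (fun y : ℝ => y ^ (2 - 1) • (Iio (1 : ℝ)).indicator g y) =
      (Iio (1 : ℝ)).indicator fun y => y * g y := by
    ext y
    by_cases hy : y < 1 <;> simp [indicator, hy]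
  rw [h1, IntegrableOn, integrable_indicator_iff measurableSet_Iio, IntegrableOn,
    Measure.restrict_restrict measurableSet_Iio, Iio_inter_Ioi, ← IntegrableOn]
  refine Integrable.mono (hg.mono_set Ioo_subset_Ioc_self)
    (measurable_id.aestronglyMeasurable.mul (hg.mono_set Ioo_subset_Ioc_self).1) ?_
  filter_upwards [ae_restrict_mem measurableSet_Ioo] with y hy
  rw [norm_mul, Real.norm_of_nonneg hy.1.le]
  exact mul_le_of_le_one_left (norm_nonneg _) hy.2.le

end Weight

theorem stmt16 (q : ℝ) (hq : 0 < q) (ω : ℝ → ℝ)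
    (hω : IsRegularWeight ω ∨ IsRapidlyIncreasing ω) :
    ∃ (f : ℂ → ℂ) (Z : ℕ → ℂ),
      DifferentiableOn ℂ f unitDisc ∧ f 0 ≠ 0 ∧
      -- `f ∈ A^p_ω` for every `0 < p < q`:
      (∀ p : ℝ, 0 < p → p < q →
        IntegrableOn (fun z => ‖f z‖ ^ p * ω ‖z‖) unitDisc) ∧
      -- `Z` is the zero sequence of `f`, ordered by increasing moduli:
      (∀ k, Z k ∈ unitDisc) ∧ (∀ k, ‖Z k‖ ≤ ‖Z (k + 1)‖) ∧
      (∀ s : Finset ℕ, ∃ g : ℂ → ℂ, DifferentiableOn ℂ g unitDisc ∧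
        ∀ z ∈ unitDisc, f z = (∏ k ∈ s, (z - Z k)) * g z) ∧
      (∀ z ∈ unitDisc, f z = 0 → ∃ k, Z k = z) ∧
      -- `limsup_{n→∞} (∏_{k=1}^n 1/|z_k|) (∫_{1-1/n}^1 ω)^{1/q} > 0`:
      ∃ c : ℝ, 0 < c ∧ ∃ᶠ n : ℕ in atTop,
        c ≤ (∏ k ∈ Finset.range n, (1 / ‖Z k‖)) * (wInt ω (1 - 1 / (n : ℝ))) ^ (1 / q) := by
  have h : IsRadialContinuousWeight ω := hω.elim (·.1) (·.1)
  obtain ⟨β, hβ⟩ := exists_mul_le_mul_wInt hω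
  have hq' : 0 < 1 / q := by positivity
  obtain ⟨f, Z, hf, hf0, ⟨C, hC⟩, hZ, hZm, hfac, hzero, c, hc, hfreq⟩ :=
    exists_zeros_of_majorant (φ := fun r => wInt ω r ^ (-(1 / q))) (γ := β * (1 / q))
      (fun r hr => Real.rpow_pos_of_pos (h.1.wInt_pos hr) _)
      (fun r hr t ht hrt => Real.rpow_le_rpow_of_nonpos (h.1.wInt_pos ht)
        (h.1.wInt_antitone hr ht hrt) (by linarith))
      (fun r t hr hrt ht => by
        have hwr := h.1.wInt_pos ⟨hr, hrt.trans_lt ht⟩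
        have hwt := h.1.wInt_pos ⟨hr.trans hrt, ht⟩
        have hpos : 0 < (1 - r) / (1 - t) := div_pos (by linarith) (by linarith)
        have h1 := Real.rpow_le_rpow hwr.le (wInt_le_rpow_mul_wInt h hβ hr hrt ht) hq'.le
        rw [Real.mul_rpow (by positivity) hwt.le, ← Real.rpow_mul hpos.le] at h1
        rw [Real.rpow_neg hwr.le, Real.rpow_neg hwt.le, ← div_eq_mul_inv,
          le_div_iff₀ (by positivity), inv_mul_eq_div, div_le_iff₀ (by positivity)]
        exact h1)
      (by
        refine (tendsto_rpow_neg_nhdsGT_zero (by linarith)).comp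
          (tendsto_nhdsWithin_iff.2 ⟨?_, ?_⟩)
        · have h1 := (h.1.continuousOn_wInt 1 (by simp)).mono_left
            (nhdsWithin_mono 1 Ioo_subset_Icc_self)
          rw [nhdsWithin_Ioo_eq_nhdsLT zero_lt_one] at h1
          simpa [wInt] using h1
        · filter_upwards [Ioo_mem_nhdsLT (zero_lt_one' ℝ)] with r hr
          exact h.1.wInt_pos (Ioo_subset_Ico_self hr))
  refine ⟨f, Z, hf, hf0, fun p hp hpq => ?_, hZ, hZm, hfac, hzero, c, hc, ?_⟩
  · have hint := (integrableOn_unitDisc_of_radial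
      (integrableOn_wInt_rpow_mul h (s := p / q) ((div_lt_one hq).2 hpq))).const_mul (C ^ p)
    refine Integrable.mono hint ?_ ?_
    · refine ContinuousOn.aestronglyMeasurable ?_ isOpen_unitDisc.measurableSet
      refine (hf.continuousOn.norm.rpow_const fun _ _ => Or.inr hp.le).mul ?_
      exact h.2.comp continuous_norm.continuousOn fun z hz => ⟨norm_nonneg z, hz⟩
    · filter_upwards [ae_restrict_mem isOpen_unitDisc.measurableSet] with z hz
      have hz' : ‖z‖ ∈ Ico (0 : ℝ) 1 := ⟨norm_nonneg z, hz⟩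
      have hw := h.1.wInt_pos hz'
      have hω0 := h.1.1 _ hz'
      have hC0 : 0 ≤ C := by
        by_contra! hneg
        have h1 := (norm_nonneg _).trans (hC z hz)
        have h2 : 0 < wInt ω ‖z‖ ^ (-(1 / q)) := by positivity
        nlinarith
      rw [Real.norm_of_nonneg (by positivity), Real.norm_of_nonneg (by positivity), ← mul_assoc]
      refine mul_le_mul_of_nonneg_right ?_ hω0.le
      refine (Real.rpow_le_rpow (norm_nonneg _) (hC z hz) hp.le).trans_eq ?_
      rw [Real.mul_rpow hC0 (by positivity), ← Real.rpow_mul hw.le]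
      congr 2
      ring
  · refine hfreq.mono fun n ⟨hn, hle⟩ => ?_
    have hw := h.1.wInt_pos (one_sub_one_div_mem_Ico hn)
    rw [Real.rpow_neg hw.le, ← div_eq_mul_inv, div_le_iff₀ (by positivity)] at hle
    exact hle
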